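/- arXiv:2305.01287 — 6 statements merged into one kernel-verified Lean document; each statement's English description precedes it below -/
import Mathlib

section
/- An MRD code C strictly contained in F_{q^m}^n never splits: there do not exist nonzero codes C_1 ⊆ F_{q^m}^{n_1}, C_2 ⊆ F_{q^m}^{n_2} with n_1 + n_2 = n and Q ∈ GL_n(F_q) such that C·Q = C_1 × C_2 (coordinate-wise direct sum with disjoint coordinate blocks). -/
open Matrix Submodule

/-- Coordinatewise `q^j`-th power (Frobenius) map on vectors. -/
def frobPow (q : ℕ) {L : Type*} [Field L] {n : ℕ} (j : ℕ) (x : Fin n → L) : Fin n → L :=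
  fun a => x a ^ q ^ j

/-- The `j`-th Frobenius image `C^[j]` of a code. -/
def codeFrob (q : ℕ) {L : Type*} [Field L] {n : ℕ} (j : ℕ) (C : Submodule L (Fin n → L)) :
    Submodule L (Fin n → L) :=
  Submodule.span L (frobPow q j '' (C : Set (Fin n → L)))

/-- The `q`-sum operator `Λ_i(C) = C + C^[1] + ⋯ + C^[i]`. -/
def qsum (q : ℕ) {L : Type*} [Field L] {n : ℕ} (i : ℕ) (C : Submodule L (Fin n → L)) :
    Submodule L (Fin n → L) :=
  ⨆ j : Fin (i + 1), codeFrob q (j : ℕ) C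

/-- Rank over the subfield `Fq` of a vector with entries in `L`. -/
noncomputable def rk (Fq : Type*) {L : Type*} [Field Fq] [Field L] [Algebra Fq L] {n : ℕ}
    (x : Fin n → L) : ℕ :=
  Module.finrank Fq (Submodule.span Fq (Set.range x))

/-- The rows of the `k × n` Moore matrix of `g`. -/
def moore (q : ℕ) {L : Type*} [Field L] {n : ℕ} (g : Fin n → L) (k : ℕ) :
    Fin k → Fin n → L :=
  fun i a => g a ^ q ^ (i : ℕ)

/-- The Gabidulin code `Gab_k(g)`. -/
def Gab (q : ℕ) {L : Type*} [Field L] (k : ℕ) {n : ℕ} (g : Fin n → L) :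
    Submodule L (Fin n → L) :=
  Submodule.span L (Set.range (moore q g k))

/-- Right multiplication of a vector over `L` by a matrix over the subfield `Fq`. -/
def mulP (Fq : Type*) {L : Type*} [Field Fq] [Field L] [Algebra Fq L] {n n' : ℕ}
    (x : Fin n → L) (P : Matrix (Fin n) (Fin n') Fq) : Fin n' → L :=
  Matrix.vecMul x (P.map (algebraMap Fq L))

/-- Right multiplication by a matrix over `Fq`, as an `L`-linear map. -/
def mulPLin (Fq : Type*) {L : Type*} [Field Fq] [Field L] [Algebra Fq L] {n n' : ℕ}
    (P : Matrix (Fin n) (Fin n') Fq) : (Fin n → L) →ₗ[L] (Fin n' → L) :=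
  (P.map (algebraMap Fq L)).vecMulLinear

/-- The right stabilizer algebra of a code. -/
def stabR (Fq : Type*) {L : Type*} [Field Fq] [Field L] [Algebra Fq L] {n : ℕ}
    (C : Submodule L (Fin n → L)) : Set (Matrix (Fin n) (Fin n) Fq) :=
  {A | ∀ c ∈ C, mulP Fq c A ∈ C}

/-- The conductor of a code `C` into a code `D`. -/
def condR (Fq : Type*) {L : Type*} [Field Fq] [Field L] [Algebra Fq L] {n1 n2 : ℕ}
    (C : Submodule L (Fin n1 → L)) (D : Submodule L (Fin n2 → L)) :
    Set (Matrix (Fin n1) (Fin n2) Fq) :=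
  {A | ∀ c ∈ C, mulP Fq c A ∈ D}

/-- The product code `C1 × C2` on `Fin (n1 + n2)`. -/
def prodCode {L : Type*} [Field L] {n1 n2 : ℕ} (C1 : Submodule L (Fin n1 → L))
    (C2 : Submodule L (Fin n2 → L)) : Submodule L (Fin (n1 + n2) → L) :=
  (C1.comap (LinearMap.funLeft L L (Fin.castAdd n2))) ⊓
    (C2.comap (LinearMap.funLeft L L (Fin.natAdd n1)))

/-- A code splits if, after right multiplication by an invertible matrix over `Fq`,
it becomes a direct product of two nonzero codes on complementary coordinate blocks. -/
def Splits (Fq : Type*) {L : Type*} [Field Fq] [Field L] [Algebra Fq L] {n : ℕ}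
    (C : Submodule L (Fin n → L)) : Prop :=
  ∃ (n1 n2 : ℕ) (h : n1 + n2 = n) (C1 : Submodule L (Fin n1 → L))
    (C2 : Submodule L (Fin n2 → L)) (Q : (Matrix (Fin n) (Fin n) Fq)ˣ),
    C1 ≠ ⊥ ∧ C2 ≠ ⊥ ∧
      C.map (mulPLin Fq (Q : Matrix (Fin n) (Fin n) Fq)) =
        (prodCode C1 C2).comap (LinearMap.funLeft L L (Fin.cast h))

theorem rk_mulP_le (Fq : Type*) {L : Type*} [Field Fq] [Field L] [Algebra Fq L] {n n' : ℕ}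
    (x : Fin n → L) (P : Matrix (Fin n) (Fin n') Fq) : rk Fq (mulP Fq x P) ≤ rk Fq x := by
  unfold rk
  have : FiniteDimensional Fq (Submodule.span Fq (Set.range x)) :=
    FiniteDimensional.span_of_finite Fq (Set.finite_range x)
  apply Submodule.finrank_mono
  rw [Submodule.span_le]
  rintro _ ⟨j, rfl⟩
  simp only [mulP, Matrix.vecMul, dotProduct, Matrix.map_apply, SetLike.mem_coe]
  refine Submodule.sum_mem _ fun i _ => ?_
  rw [mul_comm, ← Algebra.smul_def]
  exact Submodule.smul_mem _ _ (Submodule.subset_span ⟨i, rfl⟩)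

theorem exists_low (Fq : Type*) {L : Type*} [Field Fq] [Field L] [Algebra Fq L] {n : ℕ}
    (D : Submodule L (Fin n → L)) (hD : D ≠ ⊥) :
    ∃ w ∈ D, w ≠ 0 ∧ rk Fq w + Module.finrank L D ≤ n + 1 := by
  have hpos : 0 < Module.finrank L D := by
    rw [Nat.pos_iff_ne_zero]
    intro h
    exact hD (Submodule.finrank_eq_zero.mp h)
  have hle : Module.finrank L D ≤ n := by
    simpa using Submodule.finrank_le D
  obtain ⟨r, hr⟩ : ∃ r, Module.finrank L D = r + 1 := ⟨Module.finrank L D - 1, by omega⟩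
  have hrn : r ≤ n := by omega
  let φ : D →ₗ[L] (Fin r → L) := (LinearMap.funLeft L L (Fin.castLE hrn)).comp D.subtype
  have hker : LinearMap.ker φ ≠ ⊥ := by
    apply LinearMap.ker_ne_bot_of_finrank_lt
    simp [hr]
  obtain ⟨w, hw, hw0⟩ := Submodule.exists_mem_ne_zero_of_ne_bot hker
  refine ⟨w, w.2, by simpa using hw0, ?_⟩
  have hz : ∀ i : Fin n, (i : ℕ) < r → (w : Fin n → L) i = 0 := by
    intro i hi
    have := congrFun (LinearMap.mem_ker.mp hw) ⟨i, hi⟩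
    simpa [φ, LinearMap.funLeft] using this
  let f : Fin (n - r) → L := fun j => (w : Fin n → L) ⟨r + j, by omega⟩
  have h1 : Submodule.span Fq (Set.range (w : Fin n → L)) ≤ Submodule.span Fq (Set.range f) := by
    rw [Submodule.span_le]
    rintro _ ⟨i, rfl⟩
    by_cases hi : (i : ℕ) < r
    · rw [hz i hi]; exact Submodule.zero_mem _
    · apply Submodule.subset_span
      refine ⟨⟨i - r, by omega⟩, ?_⟩
      simp only [f]
      apply congrArg
      apply Fin.ext
      show r + ((i : ℕ) - r) = i
      omega
  have : FiniteDimensional Fq (Submodule.span Fq (Set.range f)) :=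
    FiniteDimensional.span_of_finite Fq (Set.finite_range f)
  have h2 := Submodule.finrank_mono h1
  have h3 : Module.finrank Fq (Submodule.span Fq (Set.range f)) ≤ n - r := by
    simpa [Set.finrank] using finrank_range_le_card (R := Fq) f
  unfold rk
  omega

theorem finrank_prodCode_le {L : Type*} [Field L] {n1 n2 : ℕ} (C1 : Submodule L (Fin n1 → L))
    (C2 : Submodule L (Fin n2 → L)) :
    Module.finrank L (prodCode C1 C2) ≤ Module.finrank L C1 + Module.finrank L C2 := by
  rw [← Module.finrank_prod]
  let φ : prodCode C1 C2 →ₗ[L] C1 × C2 :=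
    LinearMap.prod
      (((LinearMap.funLeft L L (Fin.castAdd n2)).comp (prodCode C1 C2).subtype).codRestrict C1
        fun x => x.2.1)
      (((LinearMap.funLeft L L (Fin.natAdd n1)).comp (prodCode C1 C2).subtype).codRestrict C2
        fun x => x.2.2)
  apply LinearMap.finrank_le_finrank_of_injective (f := φ)
  intro x y hxy
  have h1 := congrArg (fun p => (p.1 : Fin n1 → L)) hxy
  have h2 := congrArg (fun p => (p.2 : Fin n2 → L)) hxy
  ext i
  refine Fin.addCases (fun i => ?_) (fun i => ?_) i
  · exact congrFun h1 i
  · exact congrFun h2 i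

/-- An extension by zero has no larger rank. -/
theorem rk_le_of_range (Fq : Type*) {L : Type*} [Field Fq] [Field L] [Algebra Fq L] {n n' : ℕ}
    (x : Fin n → L) (y : Fin n' → L) (h : ∀ i, x i = 0 ∨ ∃ j, x i = y j) :
    rk Fq x ≤ rk Fq y := by
  unfold rk
  have : FiniteDimensional Fq (Submodule.span Fq (Set.range y)) :=
    FiniteDimensional.span_of_finite Fq (Set.finite_range y)
  apply Submodule.finrank_mono
  rw [Submodule.span_le]
  rintro _ ⟨i, rfl⟩
  rcases h i with h | ⟨j, h⟩
  · rw [h]; exact Submodule.zero_mem _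
  · rw [h]; exact Submodule.subset_span ⟨j, rfl⟩

theorem mulP_mulP_inv (Fq : Type*) {L : Type*} [Field Fq] [Field L] [Algebra Fq L] {n : ℕ}
    (x : Fin n → L) (P R : Matrix (Fin n) (Fin n) Fq) (h : P * R = 1) :
    mulP Fq (mulP Fq x P) R = x := by
  unfold mulP
  rw [Matrix.vecMul_vecMul, ← Matrix.map_mul, h]
  simp

/-- An MRD code strictly contained in `F_{q^m}^n` never splits. -/
theorem stmt3 (Fq L : Type*) [Field Fq] [Fintype Fq] [Field L] [Fintype L] [Algebra Fq L]
    (n : ℕ) (C : Submodule L (Fin n → L)) (hCtop : C ≠ ⊤) (hCbot : C ≠ ⊥)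
    (hMRD1 : ∀ x ∈ C, x ≠ 0 → n - Module.finrank L C + 1 ≤ rk Fq x)
    (hMRD2 : ∃ x ∈ C, x ≠ 0 ∧ rk Fq x = n - Module.finrank L C + 1) :
    ¬ Splits Fq C := by
  rintro ⟨n1, n2, h, C1, C2, Q, hC1, hC2, hQ⟩
  subst h
  have hid : LinearMap.funLeft L L (Fin.cast (rfl : n1 + n2 = n1 + n2)) = LinearMap.id := by
    ext; rfl
  rw [hid, Submodule.comap_id] at hQ
  have hinj : Function.Injective (mulPLin Fq (L := L) (Q : Matrix (Fin (n1 + n2)) (Fin (n1 + n2)) Fq)) := by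
    apply Function.LeftInverse.injective (g := fun y => mulP Fq y (Q⁻¹ : (Matrix (Fin (n1 + n2)) (Fin (n1 + n2)) Fq)ˣ).1)
    intro x
    exact mulP_mulP_inv Fq x _ _ Q.mul_inv
  have hk : Module.finrank L C ≤ Module.finrank L C1 + Module.finrank L C2 := by
    rw [(Submodule.equivMapOfInjective _ hinj C).finrank_eq, hQ]
    exact finrank_prodCode_le C1 C2
  have key : ∀ y ∈ prodCode C1 C2, y ≠ 0 → n1 + n2 - Module.finrank L C + 1 ≤ rk Fq y := by
    intro y hy hy0
    rw [← hQ] at hy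
    obtain ⟨x, hx, rfl⟩ := hy
    have hx0 : x ≠ 0 := by
      rintro rfl
      exact hy0 (map_zero _)
    refine (hMRD1 x hx hx0).trans ?_
    have h1 := rk_mulP_le Fq (mulP Fq x Q.1) (Q⁻¹ : (Matrix (Fin (n1 + n2)) (Fin (n1 + n2)) Fq)ˣ).1
    rwa [mulP_mulP_inv Fq x _ _ Q.mul_inv] at h1
  have hk1 : Module.finrank L C1 ≤ n1 := by simpa using Submodule.finrank_le C1
  have hk2 : Module.finrank L C2 ≤ n2 := by simpa using Submodule.finrank_le C2
  obtain ⟨w1, hw1, hw10, hr1⟩ := exists_low Fq C1 hC1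
  obtain ⟨w2, hw2, hw20, hr2⟩ := exists_low Fq C2 hC2
  have e1 : n1 + n2 - Module.finrank L C + 1 ≤ rk Fq w1 := by
    refine (key (Fin.append w1 0) ⟨?_, ?_⟩ ?_).trans (rk_le_of_range Fq _ _ ?_)
    · have : LinearMap.funLeft L L (Fin.castAdd n2) (Fin.append w1 0) = w1 := by
        ext i; simp [LinearMap.funLeft]
      simpa [this] using hw1
    · have : LinearMap.funLeft L L (Fin.natAdd n1) (Fin.append w1 (0 : Fin n2 → L)) = 0 := by
        ext i; simp [LinearMap.funLeft]
      simp [this]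
    · intro h0
      apply hw10
      ext i
      simpa using congrFun h0 (Fin.castAdd n2 i)
    · intro i
      refine Fin.addCases (fun i => ?_) (fun i => ?_) i
      · exact Or.inr ⟨i, by simp⟩
      · exact Or.inl (by simp)
  have e2 : n1 + n2 - Module.finrank L C + 1 ≤ rk Fq w2 := by
    refine (key (Fin.append 0 w2) ⟨?_, ?_⟩ ?_).trans (rk_le_of_range Fq _ _ ?_)
    · have : LinearMap.funLeft L L (Fin.castAdd n2) (Fin.append (0 : Fin n1 → L) w2) = 0 := by
        ext i; simp [LinearMap.funLeft]
      simp [this]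
    · have : LinearMap.funLeft L L (Fin.natAdd n1) (Fin.append 0 w2) = w2 := by
        ext i; simp [LinearMap.funLeft]
      simpa [this] using hw2
    · intro h0
      apply hw20
      ext i
      simpa using congrFun h0 (Fin.natAdd n1 i)
    · intro i
      refine Fin.addCases (fun i => ?_) (fun i => ?_) i
      · exact Or.inl (by simp)
      · exact Or.inr ⟨i, by simp⟩
  have t1 : C1 = ⊤ := Submodule.eq_top_of_finrank_eq (by simp; omega)
  have t2 : C2 = ⊤ := Submodule.eq_top_of_finrank_eq (by simp; omega)
  apply hCtop
  rw [eq_top_iff]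
  intro x _
  have hx : mulPLin Fq (Q : Matrix (Fin (n1 + n2)) (Fin (n1 + n2)) Fq) x ∈ C.map (mulPLin Fq (Q : Matrix (Fin (n1 + n2)) (Fin (n1 + n2)) Fq)) := by
    rw [hQ, t1, t2]
    exact ⟨trivial, trivial⟩
  obtain ⟨z, hz, hzx⟩ := hx
  exact hinj hzx ▸ hz
end

section
/- Let C ⊆ F_{q^m}^n and s ≥ 0. Define the s-closure of C as the intersection ⋂_{j=0}^{s} (Λ_s(C))^{[-j]}. Then this intersection contains C and satisfies Λ_s of it equals Λ_s(C); moreover it equals the largest code C' ⊇ C with Λ_s(C') = Λ_s(C). -/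
open Matrix Submodule

/-- The inverse Frobenius image `D^[-j]` of a code. -/
def invFrob (q : ℕ) {L : Type*} [Field L] {n : ℕ} (j : ℕ) (D : Submodule L (Fin n → L)) :
    Submodule L (Fin n → L) :=
  Submodule.span L {x | frobPow q j x ∈ D}

lemma aux_add_pow (Fq : Type*) {L : Type*} [Field Fq] [Fintype Fq] [Field L] [Algebra Fq L]
    (j : ℕ) (x y : L) :
    (x + y) ^ Fintype.card Fq ^ j = x ^ Fintype.card Fq ^ j + y ^ Fintype.card Fq ^ j := by
  induction j with
  | zero => simp
  | succ k ih =>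
    have h := map_add (FiniteField.frobeniusAlgHom Fq L)
      (x ^ Fintype.card Fq ^ k) (y ^ Fintype.card Fq ^ k)
    simp only [FiniteField.frobeniusAlgHom_apply] at h
    rw [pow_succ, pow_mul, pow_mul, pow_mul, ih, h]

lemma aux_mem_invFrob (Fq : Type*) {L : Type*} [Field Fq] [Fintype Fq] [Field L] [Algebra Fq L]
    {n : ℕ} (j : ℕ) (D : Submodule L (Fin n → L)) (x : Fin n → L) :
    x ∈ invFrob (Fintype.card Fq) j D ↔ frobPow (Fintype.card Fq) j x ∈ D := by
  refine ⟨fun h => ?_, fun h => Submodule.subset_span h⟩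
  induction h using Submodule.span_induction with
  | mem x h => exact h
  | zero =>
    have : frobPow (Fintype.card Fq) j (0 : Fin n → L) = 0 := by
      funext a
      simp [frobPow]
    rw [this]
    exact D.zero_mem
  | add x y _ _ hx hy =>
    have : frobPow (Fintype.card Fq) j (x + y) =
        frobPow (Fintype.card Fq) j x + frobPow (Fintype.card Fq) j y := by
      funext a
      exact aux_add_pow Fq j (x a) (y a)
    rw [this]
    exact D.add_mem hx hy
  | smul c x _ hx =>
    have : frobPow (Fintype.card Fq) j (c • x) =
        (c ^ Fintype.card Fq ^ j) • frobPow (Fintype.card Fq) j x := by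
      funext a
      simp [frobPow, mul_pow]
    rw [this]
    exact D.smul_mem _ hx

lemma aux_frob_mem_qsum (q : ℕ) {L : Type*} [Field L] {n : ℕ} (s j : ℕ) (hj : j < s + 1)
    (C : Submodule L (Fin n → L)) (x : Fin n → L) (hx : x ∈ C) :
    frobPow q j x ∈ qsum q s C :=
  (le_iSup (fun j : Fin (s + 1) => codeFrob q (j : ℕ) C) ⟨j, hj⟩)
    (Submodule.subset_span ⟨x, hx, rfl⟩)

lemma aux_qsum_mono (q : ℕ) {L : Type*} [Field L] {n : ℕ} (s : ℕ)
    {C D : Submodule L (Fin n → L)} (h : C ≤ D) : qsum q s C ≤ qsum q s D :=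
  iSup_mono fun _ => Submodule.span_mono (Set.image_mono h)

/-- The `s`-closure `⋂_{j=0}^s (Λ_s(C))^[-j]` contains `C`, has the same
`Λ_s` as `C`, and is the largest such code. -/
theorem stmt6 (Fq L : Type*) [Field Fq] [Fintype Fq] [Field L] [Fintype L] [Algebra Fq L]
    (q : ℕ) (hq : q = Fintype.card Fq) (n s : ℕ) (C : Submodule L (Fin n → L)) :
    C ≤ (⨅ j ∈ Finset.range (s + 1), invFrob q j (qsum q s C)) ∧
    qsum q s (⨅ j ∈ Finset.range (s + 1), invFrob q j (qsum q s C)) = qsum q s C ∧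
    ∀ C' : Submodule L (Fin n → L), C ≤ C' → qsum q s C' = qsum q s C →
      C' ≤ ⨅ j ∈ Finset.range (s + 1), invFrob q j (qsum q s C) := by
  subst hq
  have key : ∀ C' : Submodule L (Fin n → L),
      qsum (Fintype.card Fq) s C' = qsum (Fintype.card Fq) s C →
      C' ≤ ⨅ j ∈ Finset.range (s + 1),
        invFrob (Fintype.card Fq) j (qsum (Fintype.card Fq) s C) := by
    intro C' h
    refine le_iInf₂ fun j hj x hx => ?_
    rw [aux_mem_invFrob, ← h]
    exact aux_frob_mem_qsum _ s j (Finset.mem_range.1 hj) C' x hx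
  refine ⟨key C rfl, le_antisymm ?_ (aux_qsum_mono _ s (key C rfl)), fun C' _ h => key C' h⟩
  refine iSup_le fun j => Submodule.span_le.2 ?_
  rintro _ ⟨x, hx, rfl⟩
  have hx' := (Submodule.mem_iInf _).1 hx (j : ℕ)
  have hx'' := (Submodule.mem_iInf _).1 hx' (Finset.mem_range.2 j.2)
  exact (aux_mem_invFrob Fq _ _ _).1 hx''
end

section
/- Let C = Gab_k(g) be a Gabidulin code with g of rank n and let i < n − k. Then the i-closure of C equals C, i.e., the largest code C' containing C with Λ_i(C') = Λ_i(C) is C itself. -/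
open Matrix Submodule

lemma exists_frob (Fq : Type*) {L : Type*} [Field Fq] [Fintype Fq] [Field L] [Algebra Fq L]
    (q : ℕ) (hq : q = Fintype.card Fq) (j : ℕ) :
    ∃ φ : L →ₐ[Fq] L, ∀ x, φ x = x ^ q ^ j := by
  subst hq
  induction j with
  | zero => exact ⟨AlgHom.id Fq L, fun x => by simp⟩
  | succ j ih =>
    obtain ⟨φ, h⟩ := ih
    refine ⟨(FiniteField.frobeniusAlgHom Fq L).comp φ, fun x => ?_⟩
    simp [h, ← pow_mul, pow_succ]

lemma mem_Gab_iff (q : ℕ) {L : Type*} [Field L] (k : ℕ) {n : ℕ} (g c : Fin n → L) :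
    c ∈ Gab q k g ↔ ∃ a : ℕ → L, ∀ l, c l = ∑ j ∈ Finset.range k, a j * g l ^ q ^ j := by
  unfold Gab
  rw [Submodule.mem_span_range_iff_exists_fun]
  constructor
  · rintro ⟨a, rfl⟩
    refine ⟨fun j => if h : j < k then a ⟨j, h⟩ else 0, fun l => ?_⟩
    rw [Finset.sum_range]
    simp [moore]
  · rintro ⟨a, h⟩
    refine ⟨fun j => a j, ?_⟩
    ext l
    rw [h, Finset.sum_range]
    simp [moore]

open Polynomial in
lemma top_coeff_zero (Fq : Type*) {L : Type*} [Field Fq] [Fintype Fq] [Field L] [Fintype L]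
    [Algebra Fq L] (q : ℕ) (hq : q = Fintype.card Fq) (n M : ℕ) (hM : M < n)
    (g : Fin n → L) (hg : rk Fq g = n) (d : ℕ → L)
    (hd : ∀ l, ∑ j ∈ Finset.range (M + 1), d j * g l ^ q ^ j = 0) : d M = 0 := by
  classical
  have hq1 : 1 < q := hq ▸ Fintype.one_lt_card
  let V := Submodule.span Fq (Set.range g)
  have hV : Fintype.card V = q ^ n := by
    rw [Module.card_eq_pow_finrank (K := Fq), ← hq]
    congr 1
  let P : L[X] := ∑ j ∈ Finset.range (M + 1), C (d j) * X ^ q ^ j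
  have hdeg : P.natDegree < q ^ n := by
    refine lt_of_le_of_lt (b := q ^ M) ?_ (Nat.pow_lt_pow_right hq1 hM)
    refine natDegree_sum_le_of_forall_le _ _ fun j hj => ?_
    refine (natDegree_C_mul_X_pow_le _ _).trans ?_
    exact Nat.pow_le_pow_right (by omega) (by simp at hj; omega)
  choose φ hφ using exists_frob Fq (L := L) q hq
  let T : L →ₗ[Fq] L := ∑ j ∈ Finset.range (M + 1), (LinearMap.mulLeft Fq (d j)) ∘ₗ (φ j).toLinearMap
  have hT : ∀ x, P.eval x = T x := by
    intro x
    simp [P, T, eval_finsetSum, hφ]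
  have hVT : V ≤ LinearMap.ker T := by
    refine Submodule.span_le.2 ?_
    rintro _ ⟨l, rfl⟩
    simp only [SetLike.mem_coe, LinearMap.mem_ker]
    rw [← hT]
    simpa [P, eval_finsetSum] using hd l
  have hP : P = 0 := by
    refine eq_zero_of_natDegree_lt_card_of_eval_eq_zero P (f := ((↑) : V → L))
      Subtype.val_injective (fun x => ?_) (by rw [hV]; exact hdeg)
    rw [hT]
    exact hVT x.2
  have hc : P.coeff (q ^ M) = d M := by
    simp only [P, finsetSum_coeff, coeff_C_mul, coeff_X_pow]
    rw [Finset.sum_eq_single M]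
    · simp
    · intro b _ hb
      rw [if_neg, mul_zero]
      intro h
      exact hb (Nat.pow_right_injective hq1 h).symm
    · simp
  rw [← hc, hP, coeff_zero]

lemma gab_step (Fq : Type*) {L : Type*} [Field Fq] [Fintype Fq] [Field L] [Fintype L]
    [Algebra Fq L] (q : ℕ) (hq : q = Fintype.card Fq) (n N s : ℕ) (hM : s + N < n)
    (g : Fin n → L) (hg : rk Fq g = n) (c : Fin n → L) (hc : c ∈ Gab q (N + 1) g)
    (hcs : frobPow q s c ∈ Gab q (s + N) g) : c ∈ Gab q N g := by
  rw [mem_Gab_iff] at hc hcs ⊢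
  obtain ⟨a, ha⟩ := hc
  obtain ⟨b, hb⟩ := hcs
  obtain ⟨φ, hφ⟩ := exists_frob Fq (L := L) q hq s
  have hq0 : q ≠ 0 := hq ▸ Fintype.card_ne_zero
  have key := top_coeff_zero Fq q hq n (s + N) hM g hg
    (fun j => (if s ≤ j then a (j - s) ^ q ^ s else 0) - (if j < s + N then b j else 0)) ?_
  · simp [hq0] at key
    refine ⟨a, fun l => ?_⟩
    rw [ha, Finset.sum_range_succ, key]
    simp
  · intro l
    simp only [sub_mul, Finset.sum_sub_distrib]
    have h1 : ∑ j ∈ Finset.range (s + N + 1),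
        (if s ≤ j then a (j - s) ^ q ^ s else 0) * g l ^ q ^ j = c l ^ q ^ s := by
      rw [add_assoc, Finset.sum_range_add, Finset.sum_eq_zero, zero_add, ← hφ, ha, map_sum]
      · refine Finset.sum_congr rfl fun j _ => ?_
        simp [hφ, ← pow_mul, pow_add, mul_comm, mul_pow]
      · intro j hj
        simp at hj
        simp [hj]
    have h2 : ∑ j ∈ Finset.range (s + N + 1),
        (if j < s + N then b j else 0) * g l ^ q ^ j = c l ^ q ^ s := by
      rw [Finset.sum_range_succ]
      simp only [lt_irrefl, if_false, zero_mul, add_zero]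
      refine Eq.trans ?_ (hb l).symm
      refine Finset.sum_congr rfl fun j hj => ?_
      rw [if_pos (Finset.mem_range.1 hj)]
    rw [h1, h2, sub_self]

lemma qsum_Gab_le (Fq : Type*) {L : Type*} [Field Fq] [Fintype Fq] [Field L]
    [Algebra Fq L] (q : ℕ) (hq : q = Fintype.card Fq) (n k i : ℕ) (g : Fin n → L) :
    qsum q i (Gab q k g) ≤ Gab q (i + k) g := by
  refine iSup_le fun s => Submodule.span_le.2 ?_
  rintro _ ⟨c, hc, rfl⟩
  obtain ⟨a, ha⟩ := (mem_Gab_iff q k g c).1 hc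
  obtain ⟨φ, hφ⟩ := exists_frob Fq (L := L) q hq s
  have hF : frobPow q s c = ∑ j : Fin k, (a j ^ q ^ (s : ℕ)) •
      (fun l => g l ^ q ^ ((s : ℕ) + j)) := by
    ext l
    simp only [frobPow]
    rw [← hφ, ha, map_sum, Finset.sum_range]
    simp [hφ, ← pow_mul, pow_add, mul_comm, mul_pow]
  rw [hF]
  refine Submodule.sum_mem _ fun j _ => Submodule.smul_mem _ _ ?_
  exact Submodule.subset_span ⟨⟨s + j, by omega⟩, rfl⟩

/-- For a Gabidulin code `C = Gab_k(g)` and `i < n - k`, the `i`-closure of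
`C` is `C` itself: any code `C' ⊇ C` with `Λ_i(C') = Λ_i(C)` equals `C`. -/
theorem stmt7 (Fq L : Type*) [Field Fq] [Fintype Fq] [Field L] [Fintype L] [Algebra Fq L]
    (q : ℕ) (hq : q = Fintype.card Fq) (n k i : ℕ)
    (hnm : n ≤ Module.finrank Fq L) (hk : 0 < k) (hkn : k < n) (hi : i < n - k)
    (g : Fin n → L) (hg : rk Fq g = n) :
    ∀ C' : Submodule L (Fin n → L),
      Gab q k g ≤ C' → qsum q i C' = qsum q i (Gab q k g) → C' = Gab q k g := by
  intro C' hle hC'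
  refine le_antisymm (fun c hc => ?_) hle
  have h1 : ∀ s, s ≤ i → frobPow q s c ∈ Gab q (i + k) g := by
    intro s hs
    apply qsum_Gab_le Fq q hq n k i g
    rw [← hC']
    exact le_iSup (fun j : Fin (i + 1) => codeFrob q (j : ℕ) C') ⟨s, by omega⟩
      (Submodule.subset_span ⟨c, hc, rfl⟩)
  have h2 : ∀ t, t ≤ i → c ∈ Gab q (i - t + k) g := by
    intro t
    induction t with
    | zero =>
      intro _
      have := h1 0 (Nat.zero_le _)
      have h0 : frobPow q 0 c = c := by
        ext l
        simp [frobPow]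
      rw [h0] at this
      simpa using this
    | succ t ih =>
      intro ht
      refine gab_step Fq q hq n _ (t + 1) (by omega) g hg c ?_ ?_
      · have := ih (by omega)
        rwa [show i - t + k = i - (t + 1) + k + 1 by omega] at this
      · rw [show t + 1 + (i - (t + 1) + k) = i + k by omega]
        exact h1 _ ht
  simpa using h2 i le_rfl
end

section
/- Let C = Gab_k(g) with g of rank n, let c ∈ C, and e ∈ F_{q^m}^n with rk(e) = t ≤ (n−k)/2. If P is a nonzero q-polynomial of q-degree at most t such that P(c + e) ∈ Gab_{k+t}(g), then P(e) = 0 (i.e., P vanishes on every coordinate of e), and hence the support of e is contained in the kernel of the F_q-linear map induced by P. -/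
open Matrix Submodule

/-- The `Fq`-linear map induced by a `q`-polynomial. -/
noncomputable def qLin (Fq : Type*) {L : Type*} [Field Fq] [Fintype Fq] [Field L] [Algebra Fq L]
    {K : ℕ} (f : Fin K → L) : L →ₗ[Fq] L :=
  ∑ i : Fin K, (LinearMap.mulLeft Fq (f i)) ∘ₗ
    ((FiniteField.frobeniusAlgHom Fq L) ^ (i : ℕ)).toLinearMap

lemma frob_iter (Fq : Type*) {L : Type*} [Field Fq] [Fintype Fq] [Field L] [Algebra Fq L]
    (i : ℕ) (x : L) :
    ((FiniteField.frobeniusAlgHom Fq L) ^ i) x = x ^ (Fintype.card Fq) ^ i := by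
  induction i generalizing x with
  | zero => simp
  | succ i ih =>
    rw [pow_succ, AlgHom.mul_apply, ih, FiniteField.frobeniusAlgHom_apply, ← pow_mul, pow_succ']

lemma qLin_apply (Fq : Type*) {L : Type*} [Field Fq] [Fintype Fq] [Field L] [Algebra Fq L]
    {K : ℕ} (f : Fin K → L) (x : L) :
    qLin Fq f x = ∑ i : Fin K, f i * x ^ (Fintype.card Fq) ^ (i : ℕ) := by
  simp only [qLin, LinearMap.sum_apply, LinearMap.comp_apply, LinearMap.mulLeft_apply,
    AlgHom.toLinearMap_apply, frob_iter]

/-- A `q`-polynomial of `q`-degree `< K` with kernel of dimension `≥ K` is zero. -/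
lemma qLin_eq_zero (Fq : Type*) {L : Type*} [Field Fq] [Fintype Fq] [Field L] [Fintype L]
    [Algebra Fq L] {K : ℕ} (f : Fin K → L)
    (h : K ≤ Module.finrank Fq (LinearMap.ker (qLin Fq f))) : f = 0 := by
  classical
  set q := Fintype.card Fq with hq
  have hq1 : 1 < q := Fintype.one_lt_card
  let F : Polynomial L := ∑ i : Fin K, Polynomial.monomial (q ^ (i : ℕ)) (f i)
  have hev : ∀ x, F.eval x = qLin Fq f x := by
    intro x
    simp [F, qLin_apply, Polynomial.eval_finsetSum, Polynomial.eval_monomial, ← hq]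
  have hcoef : ∀ i : Fin K, F.coeff (q ^ (i : ℕ)) = f i := by
    intro i
    simp only [F, Polynomial.finsetSum_coeff, Polynomial.coeff_monomial]
    rw [Finset.sum_eq_single i]
    · simp
    · intro b _ hb
      rw [if_neg]
      intro hh
      exact hb (Fin.ext (Nat.pow_right_injective hq1 hh))
    · simp
  have hdeg : F.degree < (q ^ K : ℕ) := by
    refine (Polynomial.degree_sum_le _ _).trans_lt ?_
    rw [Finset.sup_lt_iff (WithBot.bot_lt_coe _)]
    intro i _
    refine (Polynomial.degree_monomial_le _ _).trans_lt ?_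
    exact_mod_cast Nat.pow_lt_pow_right hq1 i.2
  have hF : F = 0 := by
    refine Polynomial.eq_zero_of_degree_lt_of_eval_finset_eq_zero
      (Set.toFinset (LinearMap.ker (qLin Fq f) : Set L)) (hdeg.trans_le ?_) ?_
    · have h1 : (Set.toFinset (LinearMap.ker (qLin Fq f) : Set L)).card
          = q ^ Module.finrank Fq (LinearMap.ker (qLin Fq f)) := by
        rw [Set.toFinset_card, ← Nat.card_eq_fintype_card, hq, ← Nat.card_eq_fintype_card]
        exact Module.natCard_eq_pow_finrank (K := Fq) (V := LinearMap.ker (qLin Fq f))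
      rw [h1]
      exact_mod_cast Nat.pow_le_pow_right hq1.le h
    · intro x hx
      rw [hev]
      simpa using hx
  funext i
  rw [← hcoef, hF]; simp

lemma mem_Gab_iff_s9 (Fq : Type*) {L : Type*} [Field Fq] [Fintype Fq] [Field L] [Algebra Fq L]
    {n K : ℕ} (g y : Fin n → L) :
    y ∈ Gab (Fintype.card Fq) K g ↔ ∃ f : Fin K → L, ∀ j, y j = qLin Fq f (g j) := by
  rw [Gab, Submodule.mem_span_range_iff_exists_fun]
  refine exists_congr fun f => ?_
  rw [funext_iff]
  refine forall_congr' fun j => ?_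
  rw [qLin_apply, eq_comm]
  simp [moore, Finset.sum_apply]

lemma rk_map_le (Fq : Type*) {L : Type*} [Field Fq] [Field L] [Fintype L] [Algebra Fq L]
    {n : ℕ} (φ : L →ₗ[Fq] L) (x : Fin n → L) : rk Fq (fun j => φ (x j)) ≤ rk Fq x := by
  have : Module.Finite Fq L := Module.Finite.of_finite
  unfold rk
  have : Set.range (fun j => φ (x j)) = φ '' Set.range x := by
    rw [← Set.range_comp]; rfl
  rw [this, ← Submodule.map_span]
  exact Submodule.finrank_map_le _ _

lemma Gab_min_dist (Fq : Type*) {L : Type*} [Field Fq] [Fintype Fq] [Field L] [Fintype L]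
    [Algebra Fq L] {n K : ℕ} (g y : Fin n → L) (hg : rk Fq g = n)
    (hy : y ∈ Gab (Fintype.card Fq) K g) (hr : rk Fq y + K ≤ n) : y = 0 := by
  have : Module.Finite Fq L := Module.Finite.of_finite
  obtain ⟨f, hf⟩ := (mem_Gab_iff_s9 Fq g y).1 hy
  set S := Submodule.span Fq (Set.range g) with hS
  have hrange : Submodule.span Fq (Set.range y) = S.map (qLin Fq f) := by
    rw [hS, Submodule.map_span, ← Set.range_comp]
    congr 2
    funext j; exact hf j
  have h1 := LinearMap.finrank_range_add_finrank_ker ((qLin Fq f).domRestrict S)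
  rw [LinearMap.range_domRestrict, ← hrange] at h1
  have h2 : Module.finrank Fq (LinearMap.ker ((qLin Fq f).domRestrict S))
      ≤ Module.finrank Fq (LinearMap.ker (qLin Fq f)) := by
    rw [← Submodule.finrank_map_subtype_eq]
    refine Submodule.finrank_mono ?_
    rintro _ ⟨x, hx, rfl⟩
    simpa using hx
  unfold rk at hg hr
  rw [← hS] at hg
  have hf0 := qLin_eq_zero Fq f (by omega)
  funext j
  rw [hf j, qLin_apply, hf0]; simp

lemma Gab_map (Fq : Type*) {L : Type*} [Field Fq] [Fintype Fq] [Field L]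
    [Algebra Fq L] {n k t : ℕ} (g c : Fin n → L) (hc : c ∈ Gab (Fintype.card Fq) k g)
    (p : Fin (t + 1) → L) :
    (fun j => qLin Fq p (c j)) ∈ Gab (Fintype.card Fq) (k + t) g := by
  obtain ⟨f, hf⟩ := (mem_Gab_iff_s9 Fq g c).1 hc
  have key : (fun j => qLin Fq p (c j)) = ∑ i : Fin (t + 1), ∑ l : Fin k,
      (p i * f l ^ (Fintype.card Fq) ^ (i : ℕ)) •
        moore (Fintype.card Fq) g (k + t) ⟨l + i, by omega⟩ := by
    funext j
    simp only [qLin_apply Fq p, Finset.sum_apply, Pi.smul_apply, smul_eq_mul, moore]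
    refine Finset.sum_congr rfl fun i _ => ?_
    rw [hf j, qLin_apply, ← frob_iter, map_sum, Finset.mul_sum]
    refine Finset.sum_congr rfl fun l _ => ?_
    rw [frob_iter, mul_pow, mul_assoc, ← pow_mul, pow_add]
  rw [key]
  exact Submodule.sum_mem _ fun i _ => Submodule.sum_mem _ fun l _ =>
    Submodule.smul_mem _ _ (Submodule.subset_span ⟨_, rfl⟩)

/-- If `c ∈ Gab_k(g)`, `rk(e) = t ≤ (n-k)/2` and `P ≠ 0` has `q`-degree `≤ t`
with `P(c+e) ∈ Gab_{k+t}(g)`, then `P(e) = 0` and `Supp(e) ⊆ ker P`. -/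
theorem stmt9 (Fq L : Type*) [Field Fq] [Fintype Fq] [Field L] [Fintype L] [Algebra Fq L]
    (q : ℕ) (hq : q = Fintype.card Fq) (n k t : ℕ)
    (hnm : n ≤ Module.finrank Fq L)
    (g : Fin n → L) (hg : rk Fq g = n)
    (c : Fin n → L) (hc : c ∈ Gab q k g)
    (e : Fin n → L) (he : rk Fq e = t) (ht : 2 * t ≤ n - k)
    (p : Fin (t + 1) → L) (hp : p ≠ 0)
    (hP : (fun j => ∑ i : Fin (t + 1), p i * (c j + e j) ^ q ^ (i : ℕ)) ∈ Gab q (k + t) g) :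
    (∀ j, ∑ i : Fin (t + 1), p i * e j ^ q ^ (i : ℕ) = 0) ∧
    ∀ x ∈ Submodule.span Fq (Set.range e), ∑ i : Fin (t + 1), p i * x ^ q ^ (i : ℕ) = 0 := by
  subst hq
  have hfin : Module.Finite Fq L := Module.Finite.of_finite
  simp only [← qLin_apply Fq p] at hP ⊢
  have main : ∀ j, qLin Fq p (e j) = 0 := by
    rcases Nat.eq_zero_or_pos t with h0 | hpos
    · intro j
      have hb : Submodule.span Fq (Set.range e) = ⊥ := by
        apply Submodule.finrank_eq_zero.1
        unfold rk at he
        omega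
      have : e j ∈ Submodule.span Fq (Set.range e) := Submodule.subset_span ⟨j, rfl⟩
      rw [hb, Submodule.mem_bot] at this
      rw [this, map_zero]
    · have hmem : (fun j => qLin Fq p (e j)) ∈ Gab (Fintype.card Fq) (k + t) g := by
        convert Submodule.sub_mem _ hP (Gab_map Fq g c hc p) using 1
        funext j
        simp
      have hr := rk_map_le Fq (qLin Fq p) e
      have := Gab_min_dist Fq g _ hg hmem (by omega)
      exact fun j => congrFun this j
  refine ⟨main, fun x hx => ?_⟩
  have hle : Submodule.span Fq (Set.range e) ≤ LinearMap.ker (qLin Fq p) := by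
    rw [Submodule.span_le]
    rintro _ ⟨j, rfl⟩
    exact main j
  exact hle hx
end

section
/- Let g ∈ F_{q^m}^n have rank n, let C = Gab_k(g) with 2k ≤ n, and let X be a k×λ matrix over F_{q^m}. Consider the code C_pub ⊆ F_{q^m}^{n+λ} generated by (X | M_k(g)) where M_k(g) is the k×n Moore matrix of g. Then Λ_1(C_pub) has a generator matrix, obtained by row operations, of the form (Y , M_{k+1}(g) ; X'' , 0), where X'' is the (k−1)×λ matrix whose j-th row (1 ≤ j ≤ k−1) is x_{j-1}^{[1]} − x_j, with x_0, ..., x_{k-1} the rows of X. -/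
open Matrix Submodule

/-- Shape of a generator matrix of `Λ_1(C_pub)` for
`C_pub = ⟨(X | M_k(g))⟩` with `k = k'+1`: it is row-equivalent to
`(Y , M_{k+1}(g) ; X'' , 0)` where the `j`-th row of `X''` is `x_{j-1}^{[1]} - x_j`. -/
theorem stmt14 (Fq L : Type*) [Field Fq] [Fintype Fq] [Field L] [Fintype L] [Algebra Fq L]
    (q : ℕ) (hq : q = Fintype.card Fq) (n lam k' : ℕ)
    (g : Fin n → L) (hg : rk Fq g = n) (h2k : 2 * (k' + 1) ≤ n)
    (X : Matrix (Fin (k' + 1)) (Fin lam) L) :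
    ∃ Y : Matrix (Fin (k' + 2)) (Fin lam) L,
      qsum q 1 (Submodule.span L (Set.range fun i : Fin (k' + 1) =>
          fun j : Fin (lam + n) => Sum.elim (X i) (moore q g (k' + 1) i) (finSumFinEquiv.symm j)))
        = Submodule.span L (Set.range (Sum.elim
            (fun i : Fin (k' + 2) => fun j : Fin (lam + n) =>
              Sum.elim (Y i) (moore q g (k' + 2) i) (finSumFinEquiv.symm j))
            (fun r : Fin k' => fun j : Fin (lam + n) =>
              Sum.elim (fun a => X r.castSucc a ^ q - X r.succ a)
                (fun _ => (0 : L)) (finSumFinEquiv.symm j)))) := by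
  classical
  have hadd : ∀ x y : L, (x + y) ^ q = x ^ q + y ^ q := by
    intro x y
    have := map_add (FiniteField.frobeniusAlgHom Fq L) x y
    simpa [hq] using this
  have hq0 : q ≠ 0 := by rw [hq]; exact Fintype.card_ne_zero
  refine ⟨fun i => Fin.lastCases (motive := fun _ => Fin lam → L)
    (fun a => X (Fin.last k') a ^ q) (fun i => X i) i, ?_⟩
  set a : Fin (k' + 1) → Fin (lam + n) → L := fun i : Fin (k' + 1) =>
          fun j : Fin (lam + n) => Sum.elim (X i) (moore q g (k' + 1) i) (finSumFinEquiv.symm j)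
    with ha
  set R : Fin (k' + 2) ⊕ Fin k' → Fin (lam + n) → L := Sum.elim _ _ with hR
  have h1 : ∀ i : Fin (k' + 1), R (Sum.inl i.castSucc) = a i := by
    intro i
    funext j
    simp only [hR, ha, Sum.elim_inl]
    rcases finSumFinEquiv.symm j with t | t <;> simp [moore]
  have h2 : R (Sum.inl (Fin.last (k' + 1))) = frobPow q 1 (a (Fin.last k')) := by
    funext j
    simp only [hR, ha, Sum.elim_inl, frobPow]
    rcases finSumFinEquiv.symm j with t | t
    · simp
    · simp [moore, pow_succ, pow_mul]
  have h3 : ∀ r : Fin k', R (Sum.inr r) = frobPow q 1 (a r.castSucc) - a r.succ := by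
    intro r
    funext j
    simp only [hR, ha, Sum.elim_inr, frobPow, Pi.sub_apply]
    rcases finSumFinEquiv.symm j with t | t
    · simp
    · simp [moore, pow_succ, pow_mul]
  clear_value R a
  have hRm : ∀ s, R s ∈ Submodule.span L (Set.range R) := fun s =>
    Submodule.subset_span ⟨s, rfl⟩
  have haR : ∀ i, a i ∈ Submodule.span L (Set.range R) := fun i => h1 i ▸ hRm _
  have hbR : ∀ i, frobPow q 1 (a i) ∈ Submodule.span L (Set.range R) := by
    intro i
    induction i using Fin.lastCases with
    | last => exact h2 ▸ hRm _
    | cast r =>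
      have : frobPow q 1 (a r.castSucc) = R (Sum.inr r) + a r.succ := by
        rw [h3]; abel
      rw [this]
      exact Submodule.add_mem _ (hRm _) (haR _)
  have haS : ∀ i, a i ∈ Submodule.span L (Set.range a) := fun i =>
    Submodule.subset_span ⟨i, rfl⟩
  have haQ : ∀ i, a i ∈ qsum q 1 (Submodule.span L (Set.range a)) := by
    intro i
    refine Submodule.mem_iSup_of_mem (0 : Fin 2) (Submodule.subset_span ⟨a i, haS i, ?_⟩)
    funext j
    simp [frobPow]
  have hbQ : ∀ i, frobPow q 1 (a i) ∈ qsum q 1 (Submodule.span L (Set.range a)) := by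
    intro i
    exact Submodule.mem_iSup_of_mem (1 : Fin 2) (Submodule.subset_span ⟨a i, haS i, rfl⟩)
  apply le_antisymm
  · refine iSup_le fun j => Submodule.span_le.2 ?_
    rintro _ ⟨c, hc, rfl⟩
    have hc' : c ∈ Submodule.span L (Set.range a) := hc
    fin_cases j
    · have h0 : frobPow q 0 c = c := by funext j; simp [frobPow]
      change frobPow q 0 c ∈ Submodule.span L (Set.range R)
      rw [h0]
      refine Submodule.span_le.2 ?_ hc'
      rintro _ ⟨i, rfl⟩
      exact haR i
    · change frobPow q 1 c ∈ Submodule.span L (Set.range R)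
      clear hc
      induction hc' using Submodule.span_induction with
      | mem x hx => obtain ⟨i, rfl⟩ := hx; exact hbR i
      | zero =>
        have : frobPow q 1 (0 : Fin (lam + n) → L) = 0 := by
          funext j; simp [frobPow, hq0]
        rw [this]; exact Submodule.zero_mem _
      | add x y _ _ hx hy =>
        have : frobPow q 1 (x + y) = frobPow q 1 x + frobPow q 1 y := by
          funext j; simp [frobPow, hadd]
        rw [this]; exact Submodule.add_mem _ hx hy
      | smul t x _ hx =>
        have : frobPow q 1 (t • x) = t ^ q • frobPow q 1 x := by
          funext j; simp [frobPow, mul_pow]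
        rw [this]; exact Submodule.smul_mem _ _ hx
  · refine Submodule.span_le.2 ?_
    rintro _ ⟨s, rfl⟩
    rcases s with i | r
    · induction i using Fin.lastCases with
      | last => rw [h2]; exact hbQ _
      | cast i => rw [h1]; exact haQ _
    · rw [h3]; exact Submodule.sub_mem _ (hbQ _) (haQ _)
end

section
/- Let C ⊆ F_{q^m}^n be a random code of dimension k (generated by a uniformly random k×n matrix of rank k). If (i+1)k ≤ n, then with high probability (probability tending to 1 as q^m → ∞) dim Λ_i(C) = (i+1)k. -/
open Matrix Submodule

/-- Row (and column) indices of the extended generator matrix. -/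
abbrev RowIdx (k i : ℕ) := Fin (i + 1) × Fin k

/-- The extended generator matrix, restricted to the columns picked by `e`. -/
def extMat {R : Type*} [CommRing R] (q k n i : ℕ) (e : RowIdx k i → Fin n)
    (G : Fin k × Fin n → R) : Matrix (RowIdx k i) (RowIdx k i) R :=
  fun a c => G (a.2, e c) ^ q ^ (a.1 : ℕ)

/-- The determinant polynomial. -/
noncomputable def detPoly (L : Type*) [Field L] (q k n i : ℕ) (e : RowIdx k i → Fin n) :
    MvPolynomial (Fin k × Fin n) L :=
  (extMat q k n i e (fun v => MvPolynomial.X v)).det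

/-- The exponent of the monomial of a permutation. -/
noncomputable def permExp (q k n i : ℕ) (e : RowIdx k i → Fin n) (σ : Equiv.Perm (RowIdx k i)) :
    (Fin k × Fin n) →₀ ℕ :=
  ∑ c, Finsupp.single ((σ c).2, e c) (q ^ ((σ c).1 : ℕ))

lemma detPoly_eq (L : Type*) [Field L] (q k n i : ℕ) (e : RowIdx k i → Fin n) :
    detPoly L q k n i e = ∑ σ : Equiv.Perm (RowIdx k i),
      MvPolynomial.monomial (permExp q k n i e σ) (((Equiv.Perm.sign σ : ℤ)) : L) := by
  unfold detPoly
  rw [Matrix.det_apply']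
  refine Finset.sum_congr rfl fun σ _ => ?_
  have h1 : ∏ c, extMat q k n i e (fun v => (MvPolynomial.X v : MvPolynomial (Fin k × Fin n) L))
      (σ c) c = MvPolynomial.monomial (permExp q k n i e σ) 1 := by
    unfold permExp
    rw [MvPolynomial.monomial_sum_one]
    refine Finset.prod_congr rfl fun c _ => ?_
    simp [extMat, MvPolynomial.X_pow_eq_monomial]
  rw [h1]
  have h2 : (((Equiv.Perm.sign σ : ℤ)) : MvPolynomial (Fin k × Fin n) L)
      = MvPolynomial.C (((Equiv.Perm.sign σ : ℤ)) : L) := by simp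
  rw [h2, MvPolynomial.C_mul_monomial, mul_one]

lemma permExp_apply (q k n i : ℕ) (e : RowIdx k i → Fin n) (he : Function.Injective e)
    (σ : Equiv.Perm (RowIdx k i)) (r : Fin k) (c : RowIdx k i) :
    permExp q k n i e σ (r, e c) = if (σ c).2 = r then q ^ ((σ c).1 : ℕ) else 0 := by
  unfold permExp
  rw [Finsupp.finsetSum_apply, Finset.sum_eq_single c]
  · simp [Finsupp.single_apply]
  · intro b _ hb
    rw [Finsupp.single_apply, if_neg]
    intro h
    exact hb (he (Prod.ext_iff.1 h).2)
  · simp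

lemma permExp_inj (q k n i : ℕ) (hq : 2 ≤ q) (e : RowIdx k i → Fin n)
    (he : Function.Injective e)
    (σ : Equiv.Perm (RowIdx k i)) (h : permExp q k n i e σ = permExp q k n i e 1) : σ = 1 := by
  ext1 c
  have h1 := DFunLike.congr_fun h (c.2, e c)
  rw [permExp_apply _ _ _ _ _ he, permExp_apply _ _ _ _ _ he] at h1
  simp only [Equiv.Perm.coe_one, id_eq, if_true] at h1
  split_ifs at h1 with h2
  · have h3 := Nat.pow_right_injective hq h1
    exact Prod.ext (Fin.ext h3) h2
  · have : 0 < q ^ (c.1 : ℕ) := by positivity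
    omega

lemma detPoly_ne_zero (L : Type*) [Field L] (q k n i : ℕ) (hq : 2 ≤ q) (e : RowIdx k i → Fin n)
    (he : Function.Injective e) : detPoly L q k n i e ≠ 0 := by
  intro h0
  have h1 := congrArg (MvPolynomial.coeff (permExp q k n i e 1)) h0
  rw [detPoly_eq, MvPolynomial.coeff_sum, Finset.sum_eq_single 1] at h1
  · simp at h1
  · intro σ _ hσ
    rw [MvPolynomial.coeff_monomial, if_neg]
    intro h
    exact hσ (permExp_inj q k n i hq e he σ h)
  · simp

lemma detPoly_degree (L : Type*) [Field L] (q k n i : ℕ) (e : RowIdx k i → Fin n) :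
    (detPoly L q k n i e).totalDegree ≤ ∑ c : RowIdx k i, q ^ (c.1 : ℕ) := by
  rw [detPoly_eq]
  refine MvPolynomial.totalDegree_finsetSum_le fun σ _ => ?_
  refine (MvPolynomial.totalDegree_monomial_le _ _).trans ?_
  rw [← Equiv.sum_comp σ (fun c : RowIdx k i => q ^ (c.1 : ℕ))]
  unfold permExp
  apply le_of_eq
  change Finsupp.degree _ = _
  rw [map_sum]
  simp

lemma detPoly_eval (L : Type*) [Field L] (q k n i : ℕ) (e : RowIdx k i → Fin n)
    (G : Fin k × Fin n → L) :
    MvPolynomial.eval G (detPoly L q k n i e) = (extMat q k n i e G).det := by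
  unfold detPoly
  rw [RingHom.map_det]
  congr 1
  ext a c
  simp [extMat]

lemma good_indep (L : Type*) [Field L] (q k n i : ℕ) (e : RowIdx k i → Fin n)
    (G : Matrix (Fin k) (Fin n) L) (h : (extMat q k n i e (fun v => G v.1 v.2)).det ≠ 0) :
    LinearIndependent L (fun a : RowIdx k i => frobPow q (a.1 : ℕ) (G a.2)) := by
  have h1 := Matrix.linearIndependent_rows_of_det_ne_zero h
  exact LinearIndependent.of_comp (LinearMap.funLeft L L e) h1

lemma good_rank (L : Type*) [Field L] (q k n i : ℕ) (e : RowIdx k i → Fin n)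
    (G : Matrix (Fin k) (Fin n) L) (h : (extMat q k n i e (fun v => G v.1 v.2)).det ≠ 0) :
    Module.finrank L (Submodule.span L (Set.range fun r : Fin k => G r)) = k := by
  have h1 := (good_indep L q k n i e G h).comp (fun r : Fin k => ((0, r) : RowIdx k i))
    (fun a b hab => (Prod.ext_iff.1 hab).2)
  have h2 : ((fun a : RowIdx k i => frobPow q (a.1 : ℕ) (G a.2)) ∘
      (fun r : Fin k => ((0, r) : RowIdx k i))) = fun r : Fin k => G r := by
    ext r a
    simp [frobPow]
  rw [h2] at h1
  rw [finrank_span_eq_card h1, Fintype.card_fin]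

lemma good_qsum (L : Type*) [Field L] (q k n i : ℕ) (e : RowIdx k i → Fin n)
    (G : Matrix (Fin k) (Fin n) L) (h : (extMat q k n i e (fun v => G v.1 v.2)).det ≠ 0) :
    (i + 1) * k ≤ Module.finrank L (qsum q i
            (Submodule.span L (Set.range fun r : Fin k => G r))) := by
  have h1 := good_indep L q k n i e G h
  have h2 := finrank_span_eq_card h1
  simp only [Fintype.card_prod, Fintype.card_fin] at h2
  rw [← h2]
  apply Submodule.finrank_mono
  rw [Submodule.span_le]
  rintro _ ⟨a, rfl⟩
  refine (le_iSup (fun j : Fin (i + 1) => codeFrob q (j : ℕ)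
    (Submodule.span L (Set.range fun r : Fin k => G r))) a.1) ?_
  exact Submodule.subset_span ⟨G a.2, Submodule.subset_span ⟨a.2, rfl⟩, rfl⟩

lemma bad_count (L : Type*) [Field L] [Fintype L] (q k n i : ℕ) (hq : 2 ≤ q)
    (e : RowIdx k i → Fin n) (he : Function.Injective e) :
    (Nat.card {G : Matrix (Fin k) (Fin n) L //
        (extMat q k n i e (fun v => G v.1 v.2)).det = 0} : ℝ) * Fintype.card L ≤
      ((∑ c : RowIdx k i, q ^ (c.1 : ℕ) : ℕ) : ℝ) *
        Nat.card (Matrix (Fin k) (Fin n) L) := by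
  classical
  let p := MvPolynomial.rename (finProdFinEquiv (m := k) (n := n)) (detPoly L q k n i e)
  have hp : p ≠ 0 := by
    intro h0
    exact detPoly_ne_zero L q k n i hq e he
      (MvPolynomial.rename_injective _ finProdFinEquiv.injective (by rw [map_zero]; exact h0))
  have hsz := MvPolynomial.schwartz_zippel_totalDegree hp (Finset.univ : Finset L)
  have hdeg : p.totalDegree ≤ ∑ c : RowIdx k i, q ^ (c.1 : ℕ) :=
    (MvPolynomial.totalDegree_rename_le _ _).trans (detPoly_degree L q k n i e)
  have hcard : Nat.card {G : Matrix (Fin k) (Fin n) L //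
        (extMat q k n i e (fun v => G v.1 v.2)).det = 0} =
      (Finset.filter (fun f => MvPolynomial.eval f p = 0)
        (Fintype.piFinset fun _ : Fin (k * n) => (Finset.univ : Finset L))).card := by
    let E : Matrix (Fin k) (Fin n) L ≃ (Fin (k * n) → L) :=
      ((Equiv.curry (Fin k) (Fin n) L).symm).trans
        (Equiv.arrowCongr finProdFinEquiv (Equiv.refl L))
    have h1 : ∀ G : Matrix (Fin k) (Fin n) L,
        (extMat q k n i e (fun v => G v.1 v.2)).det = 0 ↔ MvPolynomial.eval (E G) p = 0 := by
      intro G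
      rw [MvPolynomial.eval_rename, detPoly_eval]
      have : (E G) ∘ finProdFinEquiv = fun v => G v.1 v.2 := by
        ext v
        change (fun v : Fin k × Fin n => G v.1 v.2)
          (finProdFinEquiv.symm (finProdFinEquiv v)) = G v.1 v.2
        rw [Equiv.symm_apply_apply]
      rw [this]
    rw [Nat.card_congr (Equiv.subtypeEquiv (q := fun f => MvPolynomial.eval f p = 0) E h1),
      Nat.card_eq_fintype_card, Fintype.card_subtype]
    simp
  have hL : (0 : ℚ≥0) < (Fintype.card L : ℚ≥0) := by exact_mod_cast Fintype.card_pos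
  rw [← hcard, Finset.card_univ, div_le_div_iff₀ (by positivity) hL] at hsz
  have hM : Nat.card (Matrix (Fin k) (Fin n) L) = Fintype.card L ^ (k * n) := by
    have : Nat.card (Matrix (Fin k) (Fin n) L) = Nat.card (Fin k → Fin n → L) := rfl
    rw [this]
    simp [pow_mul, mul_comm k n]
  rw [hM]
  have hsz' : Nat.card {G : Matrix (Fin k) (Fin n) L //
        (extMat q k n i e (fun v => G v.1 v.2)).det = 0} * Fintype.card L ≤
      p.totalDegree * Fintype.card L ^ (k * n) := by exact_mod_cast hsz
  have := hsz'.trans (Nat.mul_le_mul_right _ hdeg)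
  exact_mod_cast this

/-- For a uniformly random `k × n` generator matrix of rank `k`, if
`(i+1)k ≤ n` then `dim Λ_i(rowspace) = (i+1)k` with probability tending to `1` as the
cardinality of the extension field grows. -/
theorem stmt15 (Fq : Type) [Field Fq] [Fintype Fq] (k n i : ℕ) (hk : 0 < k)
    (h : (i + 1) * k ≤ n) :
    ∀ ε : ℝ, 0 < ε → ∃ N : ℕ, ∀ (L : Type) [Field L] [Fintype L] [Algebra Fq L],
      N ≤ Fintype.card L →
      (Nat.card {G : Matrix (Fin k) (Fin n) L //
          Module.finrank L (Submodule.span L (Set.range fun r : Fin k => G r)) = k ∧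
          Module.finrank L (qsum (Fintype.card Fq) i
            (Submodule.span L (Set.range fun r : Fin k => G r))) < (i + 1) * k} : ℝ)
        ≤ ε * Nat.card {G : Matrix (Fin k) (Fin n) L //
            Module.finrank L (Submodule.span L (Set.range fun r : Fin k => G r)) = k} := by
  intro ε hε
  have hq : 2 ≤ Fintype.card Fq := Fintype.one_lt_card
  set q := Fintype.card Fq with hqdef
  obtain ⟨e⟩ : Nonempty (RowIdx k i ↪ Fin n) :=
    Function.Embedding.nonempty_of_card_le (by simpa using h)
  set D : ℕ := ∑ c : RowIdx k i, q ^ (c.1 : ℕ) with hD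
  obtain ⟨N, hN⟩ := exists_nat_ge ((D : ℝ) * (1 + ε) / ε)
  refine ⟨N, ?_⟩
  intro L _ _ _ hNL
  have hbad := bad_count L q k n i hq e e.injective
  rw [← hD] at hbad
  have hQ : (0 : ℝ) < Fintype.card L := by exact_mod_cast Fintype.card_pos
  have hDQ : (D : ℝ) * (1 + ε) ≤ ε * Fintype.card L := by
    rw [div_le_iff₀ hε] at hN
    have : (N : ℝ) ≤ Fintype.card L := by exact_mod_cast hNL
    nlinarith
  have hA : Nat.card {G : Matrix (Fin k) (Fin n) L //
          Module.finrank L (Submodule.span L (Set.range fun r : Fin k => G r)) = k ∧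
          Module.finrank L (qsum q i
            (Submodule.span L (Set.range fun r : Fin k => G r))) < (i + 1) * k} ≤
      Nat.card {G : Matrix (Fin k) (Fin n) L //
        (extMat q k n i e (fun v => G v.1 v.2)).det = 0} := by
    refine Nat.card_le_card_of_injective (Subtype.map id ?_)
      (Subtype.map_injective _ Function.injective_id)
    intro G hG
    by_contra hne
    exact absurd (good_qsum L q k n i e G hne) (not_le.2 hG.2)
  have hB : Nat.card {G : Matrix (Fin k) (Fin n) L //
        ¬ (extMat q k n i e (fun v => G v.1 v.2)).det = 0} ≤
      Nat.card {G : Matrix (Fin k) (Fin n) L //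
            Module.finrank L (Submodule.span L (Set.range fun r : Fin k => G r)) = k} := by
    refine Nat.card_le_card_of_injective (Subtype.map id ?_)
      (Subtype.map_injective _ Function.injective_id)
    intro G hG
    exact good_rank L q k n i e G hG
  have hC : Nat.card {G : Matrix (Fin k) (Fin n) L //
        (extMat q k n i e (fun v => G v.1 v.2)).det = 0} +
      Nat.card {G : Matrix (Fin k) (Fin n) L //
        ¬ (extMat q k n i e (fun v => G v.1 v.2)).det = 0} =
      Nat.card (Matrix (Fin k) (Fin n) L) := by
    classical
    rw [← Nat.card_sum]
    exact Nat.card_congr (Equiv.sumCompl _)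
  generalize Nat.card {G : Matrix (Fin k) (Fin n) L //
        (extMat q k n i e (fun v => G v.1 v.2)).det = 0} = z at *
  generalize Nat.card {G : Matrix (Fin k) (Fin n) L //
        ¬ (extMat q k n i e (fun v => G v.1 v.2)).det = 0} = w at *
  generalize Nat.card (Matrix (Fin k) (Fin n) L) = T at *
  have hA' := (Nat.cast_le (α := ℝ)).2 hA
  have hB' := (Nat.cast_le (α := ℝ)).2 hB
  have hC' : (z : ℝ) + w = T := by exact_mod_cast hC
  refine hA'.trans (le_trans ?_ (mul_le_mul_of_nonneg_left hB' hε.le))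
  have h1 : (z : ℝ) * (1 + ε) ≤ ε * T := by
    have hT : (0 : ℝ) ≤ T := Nat.cast_nonneg _
    have h2 : ((z : ℝ) * (1 + ε)) * Fintype.card L ≤ (ε * T) * Fintype.card L := by
      nlinarith [mul_le_mul_of_nonneg_right hbad (by positivity : (0 : ℝ) ≤ 1 + ε),
        mul_le_mul_of_nonneg_right hDQ hT]
    exact le_of_mul_le_mul_right h2 hQ
  rw [← hC'] at h1
  linarith
end
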